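/- Let p ∈ (1,∞) and let F be a nonempty subset of P_p(ℝ) that is displacement convex and closed with respect to W_p. Let T : ℝ → ℝ be the affine map T(x) = a + bx with a ∈ ℝ and b ≠ 0, and suppose F is invariant under T, i.e. F = {T_#ν : ν ∈ F}. Then for every μ ∈ P_p(ℝ), proj_F^{(p)}(T_#μ) = T_#(proj_F^{(p)} μ), where T_#μ denotes the pushforward of μ under T. -/

import Mathlib

open MeasureTheory Set Filter

noncomputable def quantile (μ : MeasureTheory.Measure ℝ) (u : ℝ) : ℝ :=
  sInf {x : ℝ | u ≤ (μ (Set.Iic x)).toReal}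

def HasFiniteMomentP (p : ℝ) (μ : MeasureTheory.Measure ℝ) : Prop :=
  MeasureTheory.IsProbabilityMeasure μ ∧
    MeasureTheory.Integrable (fun x => |x| ^ p) μ

noncomputable def Wdist (p : ℝ) (μ ν : MeasureTheory.Measure ℝ) : ℝ :=
  (∫ u in Set.Ioo (0:ℝ) 1, |quantile μ u - quantile ν u| ^ p) ^ (1 / p)

def DisplacementConvex (F : Set (MeasureTheory.Measure ℝ)) : Prop :=
  ∀ μ ∈ F, ∀ ν ∈ F, ∀ t ∈ Set.Icc (0:ℝ) 1, ∃ σ ∈ F,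
    ∀ u ∈ Set.Ioo (0:ℝ) 1,
      quantile σ u = (1 - t) * quantile μ u + t * quantile ν u

def WClosed (p : ℝ) (F : Set (MeasureTheory.Measure ℝ)) : Prop :=
  ∀ (μs : ℕ → MeasureTheory.Measure ℝ) (μ : MeasureTheory.Measure ℝ),
    (∀ n, μs n ∈ F) → HasFiniteMomentP p μ →
    Filter.Tendsto (fun n => Wdist p (μs n) μ) Filter.atTop (nhds 0) → μ ∈ F

theorem quantile_le_iff (μ : Measure ℝ) [IsProbabilityMeasure μ] {u : ℝ}
    (hu : u ∈ Ioo (0 : ℝ) 1) (x : ℝ) :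
    quantile μ u ≤ x ↔ u ≤ (μ (Iic x)).toReal := by
  have hcdf : ∀ y, (μ (Iic y)).toReal = ProbabilityTheory.cdf μ y := fun y =>
    (ProbabilityTheory.cdf_eq_real μ y).symm
  have hbdd : BddBelow {y : ℝ | u ≤ (μ (Iic y)).toReal} := by
    obtain ⟨c, hc⟩ :=
      ((ProbabilityTheory.tendsto_cdf_atBot μ).eventually (gt_mem_nhds hu.1)).exists
    refine ⟨c, fun y hy => le_of_lt ?_⟩
    by_contra! h
    have := ProbabilityTheory.monotone_cdf μ h
    rw [mem_ofPred_eq, hcdf] at hy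
    linarith
  have hne : {y : ℝ | u ≤ (μ (Iic y)).toReal}.Nonempty := by
    obtain ⟨c, hc⟩ :=
      ((ProbabilityTheory.tendsto_cdf_atTop μ).eventually (lt_mem_nhds hu.2)).exists
    exact ⟨c, by rw [mem_ofPred_eq, hcdf]; exact hc.le⟩
  refine ⟨fun h => ?_, fun h => csInf_le hbdd h⟩
  have hright : ∀ y > x, u ≤ ProbabilityTheory.cdf μ y := by
    intro y hy
    obtain ⟨z, hz, hzy⟩ := exists_lt_of_csInf_lt hne (lt_of_le_of_lt h hy)
    rw [mem_ofPred_eq, hcdf] at hz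
    exact hz.trans (ProbabilityTheory.monotone_cdf μ hzy.le)
  rw [hcdf]
  have hcont : Tendsto (ProbabilityTheory.cdf μ) (nhdsWithin x (Ioi x))
      (nhds (ProbabilityTheory.cdf μ x)) :=
    ((ProbabilityTheory.cdf μ).right_continuous x).mono_left
      (nhdsWithin_mono x Ioi_subset_Ici_self)
  exact ge_of_tendsto hcont (eventually_nhdsWithin_of_forall hright)

theorem monotoneOn_quantile (μ : Measure ℝ) [IsProbabilityMeasure μ] :
    MonotoneOn (quantile μ) (Ioo 0 1) := fun _ hu _ hv huv =>
  (quantile_le_iff μ hu _).2 (huv.trans ((quantile_le_iff μ hv _).1 le_rfl))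

theorem aemeasurable_quantile (μ : Measure ℝ) [IsProbabilityMeasure μ] :
    AEMeasurable (quantile μ) (volume.restrict (Ioo 0 1)) :=
  aemeasurable_restrict_of_monotoneOn measurableSet_Ioo (monotoneOn_quantile μ)

theorem map_quantile (μ : Measure ℝ) [IsProbabilityMeasure μ] :
    (volume.restrict (Ioo (0 : ℝ) 1)).map (quantile μ) = μ := by
  refine Measure.ext_of_Iic _ _ fun x => ?_
  rw [Measure.map_apply_of_aemeasurable (aemeasurable_quantile μ) measurableSet_Iic,
    Measure.restrict_apply' measurableSet_Ioo]
  have h1 : (μ (Iic x)).toReal ≤ 1 := measureReal_le_one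
  have hset : quantile μ ⁻¹' Iic x ∩ Ioo 0 1 = Ioo 0 1 ∩ Iic (μ (Iic x)).toReal := by
    ext u
    constructor
    · rintro ⟨h, hu⟩
      exact ⟨hu, (quantile_le_iff μ hu x).1 h⟩
    · rintro ⟨hu, h⟩
      exact ⟨(quantile_le_iff μ hu x).2 h, hu⟩
  rw [hset]
  apply le_antisymm
  · calc volume (Ioo 0 1 ∩ Iic (μ (Iic x)).toReal)
        ≤ volume (Ioc 0 (μ (Iic x)).toReal) := measure_mono fun u hu => ⟨hu.1.1, hu.2⟩
      _ = μ (Iic x) := by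
        rw [Real.volume_Ioc, sub_zero, ENNReal.ofReal_toReal (measure_ne_top _ _)]
  · calc μ (Iic x) = volume (Ioo 0 (μ (Iic x)).toReal) := by
          rw [Real.volume_Ioo, sub_zero, ENNReal.ofReal_toReal (measure_ne_top _ _)]
      _ ≤ volume (Ioo 0 1 ∩ Iic (μ (Iic x)).toReal) :=
        measure_mono fun u hu => ⟨⟨hu.1, hu.2.trans_le h1⟩, hu.2.le⟩

theorem eq_of_quantile_ae_eq {μ ν : Measure ℝ} [IsProbabilityMeasure μ] [IsProbabilityMeasure ν]
    (h : quantile μ =ᵐ[volume.restrict (Ioo 0 1)] quantile ν) : μ = ν := by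
  rw [← map_quantile μ, ← map_quantile ν, Measure.map_congr h]

theorem HasFiniteMomentP.memLp_id {p : ℝ} (hp : 0 < p) {μ : Measure ℝ}
    (hμ : HasFiniteMomentP p μ) : MemLp id (ENNReal.ofReal p) μ := by
  rw [← integrable_norm_rpow_iff aestronglyMeasurable_id (by simpa using hp)
    ENNReal.ofReal_ne_top, ENNReal.toReal_ofReal hp.le]
  exact hμ.2

theorem memLp_quantile {p : ℝ} (hp : 1 < p) {μ : Measure ℝ} (hμ : HasFiniteMomentP p μ) :
    MemLp (quantile μ) (ENNReal.ofReal p) (volume.restrict (Ioo 0 1)) := by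
  have := hμ.1
  have hp0 : 0 < p := by linarith
  have hid := hμ.memLp_id hp0
  rw [← map_quantile μ] at hid
  exact (memLp_map_measure_iff aestronglyMeasurable_id (aemeasurable_quantile μ)).1 hid

theorem integrable_abs_quantile_sub_rpow {p : ℝ} (hp : 1 < p) {μ ν : Measure ℝ}
    (hμ : HasFiniteMomentP p μ) (hν : HasFiniteMomentP p ν) :
    Integrable (fun u => |quantile μ u - quantile ν u| ^ p) (volume.restrict (Ioo 0 1)) := by
  have hp0 : 0 < p := by linarith
  have h := ((memLp_quantile hp hμ).sub (memLp_quantile hp hν)).integrable_norm_rpow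
    (by simpa using hp0) ENNReal.ofReal_ne_top
  rw [ENNReal.toReal_ofReal hp0.le] at h
  exact h

theorem measurePreserving_one_sub_Ioo :
    MeasurePreserving (fun u : ℝ => 1 - u) (volume.restrict (Ioo 0 1))
      (volume.restrict (Ioo 0 1)) := by
  have h := (Measure.measurePreserving_sub_left (volume : Measure ℝ) 1).restrict_preimage
    (measurableSet_Ioo (a := (0 : ℝ)) (b := 1))
  simpa using h

theorem ae_eq_of_ae_le_of_map_eq {α : Type*} [MeasurableSpace α] {P : Measure α}
    [IsFiniteMeasure P] {f g : α → ℝ} (hf : AEMeasurable f P) (hg : AEMeasurable g P)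
    (hle : f ≤ᵐ[P] g) (hmap : P.map f = P.map g) : f =ᵐ[P] g := by
  have hint : ∀ {k : α → ℝ}, AEMeasurable k P → Integrable (fun x => Real.arctan (k x)) P := by
    intro k hk
    refine Integrable.of_bound
      (Real.continuous_arctan.measurable.comp_aemeasurable hk).aestronglyMeasurable
      (Real.pi / 2) (Eventually.of_forall fun x => ?_)
    rw [Real.norm_eq_abs, abs_le]
    exact ⟨(Real.neg_pi_div_two_lt_arctan _).le, (Real.arctan_lt_pi_div_two _).le⟩
  have heq : ∫ x, Real.arctan (f x) ∂P = ∫ x, Real.arctan (g x) ∂P := by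
    rw [← integral_map hf Real.continuous_arctan.aestronglyMeasurable, hmap,
      integral_map hg Real.continuous_arctan.aestronglyMeasurable]
  have hle' : (fun x => Real.arctan (f x)) ≤ᵐ[P] fun x => Real.arctan (g x) := by
    filter_upwards [hle] with x hx using Real.arctan_strictMono.monotone hx
  filter_upwards [(integral_eq_iff_of_ae_le (hint hf) (hint hg) hle').1 heq] with x hx
  exact Real.arctan_injective hx

theorem quantile_map_affine_of_pos (μ : Measure ℝ) [IsProbabilityMeasure μ] (a : ℝ) {b : ℝ}
    (hb : 0 < b) {u : ℝ} (hu : u ∈ Ioo (0 : ℝ) 1) :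
    quantile (μ.map fun x => a + b * x) u = a + b * quantile μ u := by
  have hT : Measurable fun x : ℝ => a + b * x := by fun_prop
  have := Measure.isProbabilityMeasure_map (μ := μ) hT.aemeasurable
  refine eq_of_forall_ge_iff fun y => ?_
  have hpre : (fun x : ℝ => a + b * x) ⁻¹' Iic y = Iic ((y - a) / b) := by
    ext x
    rw [mem_preimage, mem_Iic, mem_Iic, le_div_iff₀ hb]
    constructor <;> intro h <;> linarith
  rw [quantile_le_iff _ hu, Measure.map_apply hT measurableSet_Iic, hpre,
    ← quantile_le_iff μ hu, le_div_iff₀ hb]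
  constructor <;> intro h <;> linarith

theorem quantile_map_affine_of_neg (μ : Measure ℝ) [IsProbabilityMeasure μ] (a : ℝ) {b : ℝ}
    (hb : b < 0) :
    quantile (μ.map fun x => a + b * x) =ᵐ[volume.restrict (Ioo 0 1)]
      fun u => a + b * quantile μ (1 - u) := by
  have hT : Measurable fun x : ℝ => a + b * x := by fun_prop
  have := Measure.isProbabilityMeasure_map (μ := μ) hT.aemeasurable
  have hrefl := measurePreserving_one_sub_Ioo
  have hq : AEMeasurable (fun u => quantile μ (1 - u)) (volume.restrict (Ioo 0 1)) :=
    (aemeasurable_quantile μ).comp_quasiMeasurePreserving hrefl.quasiMeasurePreserving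
  refine ae_eq_of_ae_le_of_map_eq (aemeasurable_quantile _) (hT.comp_aemeasurable hq) ?_ ?_
  · filter_upwards [ae_restrict_mem measurableSet_Ioo] with u hu
    have hu' : 1 - u ∈ Ioo (0 : ℝ) 1 := ⟨by linarith [hu.2], by linarith [hu.1]⟩
    rw [quantile_le_iff _ hu, Measure.map_apply hT measurableSet_Iic]
    have hpre : (fun x : ℝ => a + b * x) ⁻¹' Iic (a + b * quantile μ (1 - u)) =
        (Iio (quantile μ (1 - u)))ᶜ := by
      ext x
      simp [mul_le_mul_left_of_neg hb]
    have hIio : μ.real (Iio (quantile μ (1 - u))) ≤ 1 - u := by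
      obtain ⟨x, hmono, hlt, hx⟩ := exists_seq_strictMono_tendsto (quantile μ (1 - u))
      have hunion : ⋃ n, Iic (x n) = Iio (quantile μ (1 - u)) :=
        iUnion_Iic_eq_Iio_of_lt_of_tendsto hlt hx
      have hlim : Tendsto (fun n => μ (Iic (x n))) atTop (nhds (μ (⋃ n, Iic (x n)))) :=
        tendsto_measure_iUnion_atTop fun i j hij => Iic_subset_Iic.2 (hmono.monotone hij)
      rw [hunion] at hlim
      refine le_of_tendsto ((ENNReal.tendsto_toReal (measure_ne_top _ _)).comp hlim)
        (Eventually.of_forall fun n => ?_)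
      by_contra! h
      exact absurd ((quantile_le_iff μ hu' _).2 h.le) (not_le.2 (hlt n))
    have := probReal_compl_eq_one_sub (μ := μ) (measurableSet_Iio (a := quantile μ (1 - u)))
    rw [hpre, ← measureReal_def, this]
    linarith
  · have hcomp : (volume.restrict (Ioo (0 : ℝ) 1)).map (fun u => quantile μ (1 - u)) = μ := by
      have h := AEMeasurable.map_map_of_aemeasurable (μ := volume.restrict (Ioo (0 : ℝ) 1))
        (f := fun u => 1 - u) (g := quantile μ)
        (by rw [hrefl.map_eq]; exact aemeasurable_quantile μ) hrefl.aemeasurable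
      rw [hrefl.map_eq, map_quantile] at h
      exact h.symm
    rw [map_quantile]
    conv_lhs => rw [← hcomp]
    exact AEMeasurable.map_map_of_aemeasurable hT.aemeasurable hq

theorem Wdist_map_affine {p : ℝ} (hp : 0 < p) (μ ν : Measure ℝ) [IsProbabilityMeasure μ]
    [IsProbabilityMeasure ν] (a : ℝ) {b : ℝ} (hb : b ≠ 0) :
    Wdist p (μ.map fun x => a + b * x) (ν.map fun x => a + b * x) = |b| * Wdist p μ ν := by
  have hscale : ∀ x y : ℝ, |a + b * x - (a + b * y)| ^ p = |b| ^ p * |x - y| ^ p := by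
    intro x y
    rw [← Real.mul_rpow (abs_nonneg _) (abs_nonneg _), ← abs_mul]
    ring_nf
  have hint : ∫ u in Ioo (0 : ℝ) 1, |quantile (μ.map fun x => a + b * x) u
      - quantile (ν.map fun x => a + b * x) u| ^ p
      = |b| ^ p * ∫ u in Ioo (0 : ℝ) 1, |quantile μ u - quantile ν u| ^ p := by
    rcases hb.lt_or_gt with hb | hb
    · rw [← integral_const_mul]
      have hmp := measurePreserving_one_sub_Ioo.integral_comp
        (Homeomorph.subLeft (1 : ℝ)).measurableEmbedding
        (fun u => |b| ^ p * |quantile μ u - quantile ν u| ^ p)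
      rw [← hmp]
      refine integral_congr_ae ?_
      filter_upwards [quantile_map_affine_of_neg μ a hb, quantile_map_affine_of_neg ν a hb]
        with u h1 h2
      rw [h1, h2, hscale]
    · rw [← integral_const_mul]
      refine setIntegral_congr_fun measurableSet_Ioo fun u hu => ?_
      simp only [quantile_map_affine_of_pos μ a hb hu, quantile_map_affine_of_pos ν a hb hu,
        hscale]
  rw [Wdist, Wdist, hint, Real.mul_rpow (by positivity)
    (integral_nonneg fun _ => by positivity), ← Real.rpow_mul (abs_nonneg b),
    mul_one_div_cancel hp.ne', Real.rpow_one]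

theorem abs_midpoint_rpow_le {p : ℝ} (hp : 1 < p) (x y : ℝ) :
    |(x + y) / 2| ^ p ≤ (|x| ^ p + |y| ^ p) / 2 := by
  have h1 : |(x + y) / 2| ≤ (|x| + |y|) / 2 := by
    rw [abs_div, abs_two]
    linarith [abs_add_le x y]
  have h2 := (convexOn_rpow hp.le).2 (abs_nonneg x) (abs_nonneg y)
    (by norm_num : (0 : ℝ) ≤ 1 / 2) (by norm_num : (0 : ℝ) ≤ 1 / 2) (by norm_num)
  simp only [smul_eq_mul] at h2
  calc |(x + y) / 2| ^ p ≤ (1 / 2 * |x| + 1 / 2 * |y|) ^ p := by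
        refine Real.rpow_le_rpow (abs_nonneg _) (by linarith) (by linarith)
    _ ≤ _ := by linarith

theorem eq_of_abs_midpoint_rpow_eq {p : ℝ} (hp : 1 < p) {x y : ℝ}
    (h : |(x + y) / 2| ^ p = (|x| ^ p + |y| ^ p) / 2) : x = y := by
  have hp0 : 0 < p := by linarith
  have h1 : |(x + y) / 2| ≤ (|x| + |y|) / 2 := by
    rw [abs_div, abs_two]
    linarith [abs_add_le x y]
  by_cases hxy : |x| = |y|
  · rcases abs_eq_abs.1 hxy with hxy | rfl
    · exact hxy
    · rw [neg_add_cancel, zero_div, abs_zero, Real.zero_rpow hp0.ne', abs_neg] at h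
      have h0 : |y| ^ p = 0 := by linarith
      have hy : y = 0 := abs_eq_zero.1 ((Real.rpow_eq_zero (abs_nonneg y) hp0.ne').1 h0)
      rw [hy, neg_zero]
  · have h2 := (strictConvexOn_rpow hp).2 (abs_nonneg x) (abs_nonneg y) hxy
      (by norm_num : (0 : ℝ) < 1 / 2) (by norm_num : (0 : ℝ) < 1 / 2) (by norm_num)
    simp only [smul_eq_mul] at h2
    have h3 : |(x + y) / 2| ^ p ≤ (1 / 2 * |x| + 1 / 2 * |y|) ^ p :=
      Real.rpow_le_rpow (abs_nonneg _) (by linarith) hp0.le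
    linarith

theorem Wdist_le_Wdist_iff {p : ℝ} (hp : 0 < p) (μ ν ρ σ : Measure ℝ) :
    Wdist p μ ν ≤ Wdist p ρ σ ↔
      ∫ u in Ioo (0 : ℝ) 1, |quantile μ u - quantile ν u| ^ p ≤
        ∫ u in Ioo (0 : ℝ) 1, |quantile ρ u - quantile σ u| ^ p :=
  Real.rpow_le_rpow_iff (integral_nonneg fun _ => by positivity)
    (integral_nonneg fun _ => by positivity) (by positivity)

theorem DisplacementConvex.eq_of_forall_Wdist_le {p : ℝ} (hp : 1 < p) {F : Set (Measure ℝ)}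
    (hF : DisplacementConvex F) (hFmom : ∀ ν ∈ F, HasFiniteMomentP p ν) {μ ρ σ : Measure ℝ}
    (hμ : HasFiniteMomentP p μ) (hρ : ρ ∈ F) (hσ : σ ∈ F)
    (hρmin : ∀ ν ∈ F, Wdist p ρ μ ≤ Wdist p ν μ) (hσmin : ∀ ν ∈ F, Wdist p σ μ ≤ Wdist p ν μ) :
    ρ = σ := by
  have hp0 : 0 < p := by linarith
  obtain ⟨τ, hτ, hquant⟩ := hF ρ hρ σ hσ (1 / 2) ⟨by norm_num, by norm_num⟩
  have := (hFmom ρ hρ).1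
  have := (hFmom σ hσ).1
  have hiρ := integrable_abs_quantile_sub_rpow hp (hFmom ρ hρ) hμ
  have hiσ := integrable_abs_quantile_sub_rpow hp (hFmom σ hσ) hμ
  have hiτ := integrable_abs_quantile_sub_rpow hp (hFmom τ hτ) hμ
  have hmid : ∀ u ∈ Ioo (0 : ℝ) 1, quantile τ u - quantile μ u =
      ((quantile ρ u - quantile μ u) + (quantile σ u - quantile μ u)) / 2 := by
    intro u hu
    rw [hquant u hu]
    ring
  have hiavg : Integrable (fun u => (|quantile ρ u - quantile μ u| ^ p +
      |quantile σ u - quantile μ u| ^ p) / 2) (volume.restrict (Ioo 0 1)) :=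
    (hiρ.add hiσ).div_const 2
  have hle : (fun u => |quantile τ u - quantile μ u| ^ p) ≤ᵐ[volume.restrict (Ioo 0 1)]
      fun u => (|quantile ρ u - quantile μ u| ^ p + |quantile σ u - quantile μ u| ^ p) / 2 := by
    filter_upwards [ae_restrict_mem measurableSet_Ioo] with u hu
    rw [hmid u hu]
    exact abs_midpoint_rpow_le hp _ _
  have heq := (integral_eq_iff_of_ae_le hiτ hiavg hle).1 <| by
    refine le_antisymm (integral_mono_ae hiτ hiavg hle) ?_
    rw [integral_div, integral_add hiρ hiσ]
    have h1 := (Wdist_le_Wdist_iff hp0 _ _ _ _).1 (hρmin τ hτ)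
    have h2 := (Wdist_le_Wdist_iff hp0 _ _ _ _).1 (hσmin τ hτ)
    linarith
  refine eq_of_quantile_ae_eq ?_
  filter_upwards [heq, ae_restrict_mem measurableSet_Ioo] with u h hu
  rw [hmid u hu] at h
  linarith [eq_of_abs_midpoint_rpow_eq hp h]

theorem HasFiniteMomentP.map_affine {p : ℝ} (hp : 1 < p) {μ : Measure ℝ}
    (hμ : HasFiniteMomentP p μ) (a b : ℝ) : HasFiniteMomentP p (μ.map fun x => a + b * x) := by
  have := hμ.1
  have hp0 : 0 < p := by linarith
  have hT : Measurable fun x : ℝ => a + b * x := by fun_prop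
  refine ⟨Measure.isProbabilityMeasure_map hT.aemeasurable, ?_⟩
  have h := ((memLp_const a).add ((hμ.memLp_id hp0).const_mul b)).integrable_norm_rpow
    (by simpa using hp0) ENNReal.ofReal_ne_top
  rw [ENNReal.toReal_ofReal hp0.le] at h
  have hmeas : Measurable fun x : ℝ => |x| ^ p := by fun_prop
  exact (integrable_map_measure hmeas.aestronglyMeasurable hT.aemeasurable).2 h

/-- Proposition 2.12, affine equivariance.
Let `p ∈ (1, ∞)`, `F ⊆ P_p(ℝ)` nonempty, displacement convex, `W_p`-closed, and let
`T(x) = a + b x` with `b ≠ 0` be an affine map with `F = T_# F`. Then for every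
`μ ∈ P_p(ℝ)`, `proj_F^{(p)} (T_# μ) = T_# (proj_F^{(p)} μ)`: whenever `μhat` is a
minimizer over `F` for `μ` and `ρhat` is a minimizer over `F` for `T_# μ`, we have
`ρhat = T_# μhat`. -/
theorem wasserstein_projection_affine_equivariance
    (p : ℝ) (hp : 1 < p)
    (F : Set (MeasureTheory.Measure ℝ)) (hne : F.Nonempty)
    (hFmom : ∀ ν ∈ F, HasFiniteMomentP p ν)
    (hconv : DisplacementConvex F)
    (hclosed : WClosed p F)
    (a b : ℝ) (hb : b ≠ 0)
    (T : ℝ → ℝ) (hT : ∀ x, T x = a + b * x)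
    (hinv : F = {ρ | ∃ ν ∈ F, ρ = MeasureTheory.Measure.map T ν})
    (μ : MeasureTheory.Measure ℝ) (hμ : HasFiniteMomentP p μ)
    (μhat : MeasureTheory.Measure ℝ)
    (hμhatF : μhat ∈ F) (hμhatmin : ∀ ν ∈ F, Wdist p μhat μ ≤ Wdist p ν μ)
    (ρhat : MeasureTheory.Measure ℝ)
    (hρhatF : ρhat ∈ F)
    (hρhatmin : ∀ ν ∈ F,
      Wdist p ρhat (MeasureTheory.Measure.map T μ) ≤ Wdist p ν (MeasureTheory.Measure.map T μ)) :
    ρhat = MeasureTheory.Measure.map T μhat := by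
  obtain rfl : T = fun x => a + b * x := funext hT
  have hp0 : 0 < p := by linarith
  have := hμ.1
  have := (hFmom μhat hμhatF).1
  have hmem : ∀ ν ∈ F, ν.map (fun x => a + b * x) ∈ F := fun ν hν => by
    rw [hinv]
    exact ⟨ν, hν, rfl⟩
  refine hconv.eq_of_forall_Wdist_le hp hFmom (hμ.map_affine hp a b) hρhatF
    (hmem μhat hμhatF) hρhatmin fun ν hν => ?_
  rw [hinv] at hν
  obtain ⟨ν, hν, rfl⟩ := hν
  have := (hFmom ν hν).1
  rw [Wdist_map_affine hp0 _ _ a hb, Wdist_map_affine hp0 _ _ a hb]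
  exact mul_le_mul_of_nonneg_left (hμhatmin ν hν) (abs_nonneg b)
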